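/- For every t > 0, the fourth moment of the generalized secant hyperbolic density with τ = 1 equals (21π² + 9t²)/(5π² + 5t²): ∫_ℝ θ⁴·g(θ;1,t) dθ = (21π² + 9t²)/(5π² + 5t²), where g(θ;1,t) = c₁·exp(c₂θ)/(exp(2c₂θ) + 2a·exp(c₂θ) + 1) with a = cosh t, c₂ = √((π²+t²)/3), c₁ = (sinh t / t)·c₂. Since this density has mean 0 and variance 1, this value equals its coefficient of kurtosis β(t). -/

import Mathlib

open Real MeasureTheory Set

lemma integral_pow_mul_exp_neg_mul_Ioi (k : ℕ) {r : ℝ} (hr : 0 < r) :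
    ∫ u in Ioi (0 : ℝ), u ^ k * exp (-(r * u)) = k.factorial / r ^ (k + 1) := by
  have h := Real.integral_rpow_mul_exp_neg_mul_Ioi (a := k + 1) (by positivity) hr
  rw [Real.Gamma_nat_eq_factorial] at h
  simp only [add_sub_cancel_right, Real.rpow_natCast] at h
  rw [h, ← Nat.cast_add_one, Real.rpow_natCast, one_div, inv_pow, div_eq_inv_mul]

lemma integrableOn_pow_mul_exp_neg_mul_Ioi (k : ℕ) {r : ℝ} (hr : 0 < r) :
    IntegrableOn (fun u : ℝ => u ^ k * exp (-(r * u))) (Ioi 0) := by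
  refine not_imp_comm.1 integral_undef ?_
  rw [integral_pow_mul_exp_neg_mul_Ioi k hr]
  positivity

/-- The Bose–Einstein integral. -/
lemma integral_pow_div_exp_sub_one {k : ℕ} {S : ℝ}
    (hS : HasSum (fun n : ℕ => (1 : ℝ) / (n : ℝ) ^ (k + 1)) S) :
    ∫ u in Ioi (0 : ℝ), u ^ k / (exp u - 1) = k.factorial * S := by
  have hS' : HasSum (fun n : ℕ => (k.factorial : ℝ) / ((n : ℝ) + 1) ^ (k + 1))
      (k.factorial * S) := by
    have h := (hasSum_nat_add_iff' 1).2 hS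
    simp only [Finset.range_one, Finset.sum_singleton, Nat.cast_zero, ne_eq, Nat.succ_ne_zero,
      not_false_eq_true, zero_pow, div_zero, sub_zero, Nat.cast_add, Nat.cast_one] at h
    simpa [div_eq_mul_inv] using h.mul_left (k.factorial : ℝ)
  have hint (n : ℕ) := integral_pow_mul_exp_neg_mul_Ioi k (r := (n : ℝ) + 1) (by positivity)
  have hnorm (n : ℕ) : ∫ u in Ioi (0 : ℝ), ‖u ^ k * exp (-(((n : ℝ) + 1) * u))‖ =
      k.factorial / ((n : ℝ) + 1) ^ (k + 1) := by
    rw [← hint n]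
    refine setIntegral_congr_fun measurableSet_Ioi fun u (hu : 0 < u) => ?_
    exact Real.norm_of_nonneg (by positivity)
  have key := hasSum_integral_of_summable_integral_norm (μ := volume.restrict (Ioi (0 : ℝ)))
    (F := fun (n : ℕ) (u : ℝ) => u ^ k * exp (-(((n : ℝ) + 1) * u)))
    (fun n => integrableOn_pow_mul_exp_neg_mul_Ioi k (by positivity))
    (by simpa only [hnorm] using hS'.summable)
  simp only [hint] at key
  rw [← key.unique hS']
  refine setIntegral_congr_fun measurableSet_Ioi fun u (hu : 0 < u) => ?_
  have h1 : exp (-u) < 1 := by simpa using hu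
  have hg := ((hasSum_geometric_of_lt_one (exp_pos (-u)).le h1).mul_left (u ^ k * exp (-u))).tsum_eq
  have he (n : ℕ) : u ^ k * exp (-u) * exp (-u) ^ n = u ^ k * exp (-(((n : ℝ) + 1) * u)) := by
    rw [mul_assoc, ← Real.exp_nat_mul, ← Real.exp_add]
    ring_nf
  simp only [he] at hg
  rw [hg]
  have h2 : exp u - 1 ≠ 0 := by
    have := Real.one_lt_exp_iff.2 hu
    linarith
  have h3 : 1 - (exp u)⁻¹ ≠ 0 := by
    rw [← Real.exp_neg]; linarith
  have h4 := Real.exp_ne_zero u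
  rw [Real.exp_neg]
  field_simp

/-- The Fermi–Dirac integral. -/
lemma integral_pow_div_exp_add_one {k : ℕ} {S : ℝ}
    (hS : HasSum (fun n : ℕ => (1 : ℝ) / (n : ℝ) ^ (k + 1)) S) :
    ∫ u in Ioi (0 : ℝ), u ^ k / (exp u + 1) = (1 - 1 / 2 ^ k) * (k.factorial * S) := by
  have hB := integral_pow_div_exp_sub_one hS
  have hS0 : 0 < S := by
    have h := hS.summable.tsum_pos (fun n => by positivity) 1 (by simp)
    rwa [hS.tsum_eq] at h
  have hI : IntegrableOn (fun u : ℝ => u ^ k / (exp u - 1)) (Ioi 0) := by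
    refine not_imp_comm.1 integral_undef ?_
    rw [hB]
    positivity
  have hI2 := (integrableOn_Ioi_comp_mul_left_iff _ 0 (two_pos : (0 : ℝ) < 2)).2
    (by simpa using hI)
  have hB2 := integral_comp_mul_left_Ioi (fun u : ℝ => u ^ k / (exp u - 1)) 0
    (two_pos : (0 : ℝ) < 2)
  rw [mul_zero, hB] at hB2
  have hsplit : ∫ u in Ioi (0 : ℝ), u ^ k / (exp u + 1) =
      ∫ u in Ioi (0 : ℝ), (u ^ k / (exp u - 1) -
        2 / 2 ^ k * ((2 * u) ^ k / (exp (2 * u) - 1))) := by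
    refine setIntegral_congr_fun measurableSet_Ioi fun u (hu : 0 < u) => ?_
    have h1 := Real.one_lt_exp_iff.2 hu
    have h2 : exp u - 1 ≠ 0 := by linarith
    have h3 : exp u + 1 ≠ 0 := by linarith
    have h4 : exp (2 * u) - 1 = (exp u - 1) * (exp u + 1) := by
      rw [two_mul, Real.exp_add]; ring
    simp only [h4, mul_pow]
    field_simp
    ring
  rw [hsplit, integral_sub hI (hI2.const_mul _), integral_const_mul, hB, hB2, smul_eq_mul]
  ring

lemma integral_id_div_exp_add_one :
    ∫ u in Ioi (0 : ℝ), u ^ 1 / (exp u + 1) = π ^ 2 / 12 := by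
  rw [integral_pow_div_exp_add_one (k := 1) hasSum_zeta_two]
  norm_num
  ring

lemma integral_cube_div_exp_add_one :
    ∫ u in Ioi (0 : ℝ), u ^ 3 / (exp u + 1) = 7 * π ^ 4 / 120 := by
  rw [integral_pow_div_exp_add_one (k := 3) hasSum_zeta_four]
  norm_num [Nat.factorial]
  ring

/-- The Fermi function `1 / (exp u + 1)` minus the indicator of the negative half-line. -/
noncomputable def fermiTail (u : ℝ) : ℝ :=
  1 / (exp u + 1) - (Iio (0 : ℝ)).indicator 1 u

lemma fermiTail_of_nonneg {u : ℝ} (hu : 0 ≤ u) : fermiTail u = 1 / (exp |u| + 1) := by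
  simp [fermiTail, abs_of_nonneg hu, hu]

lemma fermiTail_of_neg {u : ℝ} (hu : u < 0) : fermiTail u = -(1 / (exp |u| + 1)) := by
  simp only [fermiTail, abs_of_neg hu, mem_Iio, hu, indicator_of_mem, Pi.one_apply, Real.exp_neg]
  have := Real.exp_pos u
  field_simp
  ring

lemma measurable_fermiTail : Measurable fermiTail := by
  unfold fermiTail
  exact (by fun_prop : Measurable fun u : ℝ => 1 / (exp u + 1)).sub
    (measurable_one.indicator measurableSet_Iio)

lemma abs_fermiTail (u : ℝ) : |fermiTail u| = 1 / (exp |u| + 1) := by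
  rcases lt_or_ge u 0 with hu | hu
  · rw [fermiTail_of_neg hu, abs_neg, abs_of_pos (by positivity)]
  · rw [fermiTail_of_nonneg hu, abs_of_pos (by positivity)]

lemma integrable_pow_mul_fermiTail (k : ℕ) : Integrable fun u : ℝ => u ^ k * fermiTail u := by
  have h : Integrable fun u : ℝ => |u| ^ k * exp (-(1 * |u|)) := by
    refine not_imp_comm.1 integral_undef ?_
    rw [integral_comp_abs (f := fun u => u ^ k * exp (-(1 * u))),
      integral_pow_mul_exp_neg_mul_Ioi k one_pos]
    positivity
  refine h.mono' ((by fun_prop : Measurable fun u : ℝ => u ^ k).mul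
    measurable_fermiTail).aestronglyMeasurable (.of_forall fun u => ?_)
  rw [Real.norm_eq_abs, abs_mul, abs_pow, abs_fermiTail, one_mul, Real.exp_neg, ← one_div]
  gcongr
  linarith

lemma integral_odd_pow_mul_fermiTail {k : ℕ} (hk : Odd k) :
    ∫ u : ℝ, u ^ k * fermiTail u = 2 * ∫ u in Ioi (0 : ℝ), u ^ k / (exp u + 1) := by
  rw [← integral_comp_abs]
  congr 1
  ext u
  rcases lt_or_ge u 0 with hu | hu
  · rw [fermiTail_of_neg hu, abs_of_neg hu, hk.neg_pow]
    ring
  · rw [fermiTail_of_nonneg hu, abs_of_nonneg hu]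
    ring

lemma integrable_add_pow_four_mul_fermiTail (t : ℝ) :
    Integrable fun u : ℝ => (u + t) ^ 4 * fermiTail u := by
  have h (k : ℕ) := integrable_pow_mul_fermiTail k
  refine (((((h 4).add ((h 3).const_mul (4 * t))).add ((h 2).const_mul (6 * t ^ 2))).add
    ((h 1).const_mul (4 * t ^ 3))).add ((h 0).const_mul (t ^ 4))).congr (.of_forall fun u => ?_)
  simp only [Pi.add_apply]
  ring

lemma sinh_div_cosh_add_cosh_eq {t : ℝ} (ht : 0 < t) (x : ℝ) :
    sinh t * exp x / (exp (2 * x) + 2 * cosh t * exp x + 1) =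
      (fermiTail (x - t) - fermiTail (x + t) + (Ico (-t) t).indicator 1 x) / 2 := by
  have hind : (Iio (0 : ℝ)).indicator (1 : ℝ → ℝ) (x - t) - (Iio (0 : ℝ)).indicator 1 (x + t) =
      (Ico (-t) t).indicator 1 x := by
    simp only [indicator_apply, mem_Iio, mem_Ico, Pi.one_apply]
    split_ifs <;> grind
  rw [← hind]
  unfold fermiTail
  have hx := exp_pos x
  have hT := exp_pos t
  rw [sinh_eq, cosh_eq, two_mul x, exp_add, exp_sub, exp_add, exp_neg]
  have h1 : exp x / exp t + 1 ≠ 0 := by positivity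
  have h2 : exp x * exp t + 1 ≠ 0 := by positivity
  have h3 : exp x * exp x + 2 * ((exp t + (exp t)⁻¹) / 2) * exp x + 1 =
    (exp x / exp t + 1) * (exp x * exp t + 1) := by field_simp; ring
  rw [h3]
  field_simp
  ring

lemma integral_pow_four_mul_sinh_div {t : ℝ} (ht : 0 < t) :
    ∫ x : ℝ, x ^ 4 * (sinh t * exp x / (exp (2 * x) + 2 * cosh t * exp x + 1)) =
      t * (7 * π ^ 2 + 3 * t ^ 2) * (π ^ 2 + t ^ 2) / 15 := by
  have hi (s : ℝ) : Integrable fun x : ℝ => x ^ 4 * fermiTail (x - s) := by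
    simpa using (integrable_add_pow_four_mul_fermiTail s).comp_sub_right s
  have he (s : ℝ) : ∫ x : ℝ, x ^ 4 * fermiTail (x - s) = ∫ u : ℝ, (u + s) ^ 4 * fermiTail u := by
    simpa using integral_sub_right_eq_self (fun u : ℝ => (u + s) ^ 4 * fermiTail u) s
  have hbox : ∫ x : ℝ, (Ico (-t) t).indicator (fun x => x ^ 4) x = 2 * t ^ 5 / 5 := by
    rw [integral_indicator measurableSet_Ico, integral_Ico_eq_integral_Ioc,
      ← intervalIntegral.integral_of_le (by linarith), integral_pow]
    norm_num
    ring
  have hboxi : Integrable ((Ico (-t) t).indicator fun x : ℝ => x ^ 4) :=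
    (integrable_indicator_iff measurableSet_Ico).2
      ((continuous_pow 4).integrableOn_Icc.mono_set Ico_subset_Icc_self)
  have hsplit (x : ℝ) :
      x ^ 4 * (sinh t * exp x / (exp (2 * x) + 2 * cosh t * exp x + 1)) =
        1 / 2 * (x ^ 4 * fermiTail (x - t) - x ^ 4 * fermiTail (x - -t) +
          (Ico (-t) t).indicator (fun x => x ^ 4) x) := by
    rw [sinh_div_cosh_add_cosh_eq ht, sub_neg_eq_add]
    by_cases hx : x ∈ Ico (-t) t <;> simp [hx] <;> ring
  have hdiff : (∫ u : ℝ, (u + t) ^ 4 * fermiTail u) - ∫ u : ℝ, (u + -t) ^ 4 * fermiTail u =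
      8 * t * (∫ u : ℝ, u ^ 3 * fermiTail u) + 8 * t ^ 3 * ∫ u : ℝ, u ^ 1 * fermiTail u := by
    rw [← integral_sub (integrable_add_pow_four_mul_fermiTail t)
      (integrable_add_pow_four_mul_fermiTail (-t)), ← integral_const_mul, ← integral_const_mul,
      ← integral_add ((integrable_pow_mul_fermiTail 3).const_mul _)
        ((integrable_pow_mul_fermiTail 1).const_mul _)]
    congr 1
    ext u
    ring
  have hsub : Integrable fun x : ℝ => x ^ 4 * fermiTail (x - t) - x ^ 4 * fermiTail (x - -t) :=
    (hi t).sub (hi (-t))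
  simp only [hsplit]
  rw [integral_const_mul, integral_add hsub hboxi,
    integral_sub (hi t) (hi (-t)), he, he, hbox, hdiff,
    integral_odd_pow_mul_fermiTail (by decide), integral_odd_pow_mul_fermiTail (by decide),
    integral_id_div_exp_add_one, integral_cube_div_exp_add_one]
  ring

/-- For t > 0, the fourth moment (= coefficient of kurtosis,
since the density has mean 0 and variance 1) of the generalized secant
hyperbolic density with τ = 1 equals (21π² + 9t²)/(5π² + 5t²), where
a = cosh t, c₂ = √((π²+t²)/3), c₁ = (sinh t / t)·c₂. -/
theorem gsh_fourth_moment_pos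
    (t : ℝ) (ht : 0 < t)
    (a c₁ c₂ : ℝ)
    (ha : a = Real.cosh t)
    (hc₂ : c₂ = Real.sqrt ((Real.pi ^ 2 + t ^ 2) / 3))
    (hc₁ : c₁ = (Real.sinh t / t) * c₂) :
    ∫ θ : ℝ, θ ^ 4 * (c₁ * Real.exp (c₂ * θ) /
        (Real.exp (2 * c₂ * θ) + 2 * a * Real.exp (c₂ * θ) + 1)) =
      (21 * Real.pi ^ 2 + 9 * t ^ 2) / (5 * Real.pi ^ 2 + 5 * t ^ 2) := by
  have hc : 0 < c₂ := by rw [hc₂]; positivity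
  have hsq : c₂ ^ 2 = (π ^ 2 + t ^ 2) / 3 := by rw [hc₂, Real.sq_sqrt (by positivity)]
  have hscale (θ : ℝ) : θ ^ 4 * (c₁ * exp (c₂ * θ) /
        (exp (2 * c₂ * θ) + 2 * a * exp (c₂ * θ) + 1)) =
      1 / (t * c₂ ^ 3) * ((c₂ * θ) ^ 4 * (sinh t * exp (c₂ * θ) /
        (exp (2 * (c₂ * θ)) + 2 * cosh t * exp (c₂ * θ) + 1))) := by
    rw [ha, hc₁, mul_assoc 2 c₂ θ]
    field_simp
  simp only [hscale]
  rw [integral_const_mul, Measure.integral_comp_mul_left (fun x : ℝ => x ^ 4 * (sinh t * exp x /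
    (exp (2 * x) + 2 * cosh t * exp x + 1))), integral_pow_four_mul_sinh_div ht,
    abs_of_pos (inv_pos.2 hc), smul_eq_mul]
  have h4 : c₂ ^ 3 * c₂ = ((π ^ 2 + t ^ 2) / 3) ^ 2 := by rw [← hsq]; ring
  have hpt : 0 < π ^ 2 + t ^ 2 := by positivity
  calc _ = (t * (7 * π ^ 2 + 3 * t ^ 2) * (π ^ 2 + t ^ 2) / 15) / (t * (c₂ ^ 3 * c₂)) := by
        field_simp
    _ = _ := by
        rw [h4]
        field_simp
        ring
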